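/- Let e be a positive natural number and λ > 0 a real number. The Gaussian RBF kernel is positive semidefinite: for every finite family of points z₁, …, zₙ ∈ ℝᵉ and every vector of real coefficients c₁, …, cₙ, one has ∑ᵢ∑ⱼ cᵢ cⱼ exp(−λ‖zᵢ − zⱼ‖²) ≥ 0. -/

import Mathlib

namespace Matrix.PosSemidef

variable {ι : Type*} {M : Matrix ι ι ℝ}

theorem sum_sum_mul_nonneg [Fintype ι] (hM : M.PosSemidef) (c : ι → ℝ) :
    0 ≤ ∑ i, ∑ j, c i * c j * M i j := by
  have h := hM.dotProduct_mulVec_nonneg c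
  simp only [dotProduct, mulVec, star_trivial, Finset.mul_sum] at h
  refine h.trans_eq (Finset.sum_congr rfl fun i _ ↦ Finset.sum_congr rfl fun j _ ↦ ?_)
  ring

/-- Entrywise powers of a positive semidefinite matrix are positive semidefinite. -/
theorem map_pow [Finite ι] (hM : M.PosSemidef) (k : ℕ) : (M.map (· ^ k)).PosSemidef := by
  induction k with
  | zero =>
    convert! posSemidef_vecMulVec_self_star (1 : ι → ℝ) using 1
    ext i j
    simp [vecMulVec_apply]
  | succ k ih =>
    convert! ih.hadamard hM using 1

theorem sum_sum_mul_exp_nonneg [Fintype ι] (hM : M.PosSemidef) (c : ι → ℝ) :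
    0 ≤ ∑ i, ∑ j, c i * c j * Real.exp (M i j) := by
  have h : HasSum (fun k : ℕ ↦ ∑ i, ∑ j, c i * c j * (M i j ^ k / k.factorial))
      (∑ i, ∑ j, c i * c j * Real.exp (M i j)) := by
    refine hasSum_sum fun i _ ↦ hasSum_sum fun j _ ↦ HasSum.mul_left _ ?_
    rw [Real.exp_eq_exp_ℝ]
    exact NormedSpace.expSeries_div_hasSum_exp (M i j)
  refine h.nonneg fun k ↦ ?_
  simp only [← mul_div_assoc, ← Finset.sum_div]
  exact div_nonneg ((hM.map_pow k).sum_sum_mul_nonneg c) (Nat.cast_nonneg _)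

end Matrix.PosSemidef

/-- The Gaussian RBF kernel with scale `λ > 0` is positive semidefinite on `ℝᵉ`:
every finite quadratic form `∑ᵢ∑ⱼ cᵢ cⱼ exp(−λ‖zᵢ − zⱼ‖²)` is nonnegative. -/
theorem rbf_kernel_posSemidef
    (e : ℕ) (he : 0 < e) (lam : ℝ) (hlam : 0 < lam) :
    ∀ (n : ℕ) (z : Fin n → EuclideanSpace ℝ (Fin e)) (c : Fin n → ℝ),
      0 ≤ ∑ i : Fin n, ∑ j : Fin n,
        c i * c j * Real.exp (-lam * ‖z i - z j‖ ^ 2) := by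
  intro n z c
  have hM : ((2 * lam) • Matrix.gram ℝ z).PosSemidef :=
    (Matrix.posSemidef_gram ℝ z).smul (by positivity)
  refine (hM.sum_sum_mul_exp_nonneg fun i ↦ c i * Real.exp (-lam * ‖z i‖ ^ 2)).trans_eq
    (Finset.sum_congr rfl fun i _ ↦ Finset.sum_congr rfl fun j _ ↦ ?_)
  have h : -lam * ‖z i - z j‖ ^ 2 =
      -lam * ‖z i‖ ^ 2 + -lam * ‖z j‖ ^ 2 + 2 * lam * inner ℝ (z i) (z j) := by
    rw [norm_sub_sq_real]
    ring
  rw [h, Real.exp_add, Real.exp_add, Matrix.smul_apply, Matrix.gram_apply, smul_eq_mul]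
  ring
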